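/- arXiv:math/0005227 — 5 statements merged into one kernel-verified Lean document; each statement's English description precedes it below -/
import Mathlib

section
/- Let A be a *-algebra over ℂ with an approximate identity. Then for every a ∈ A the following are equivalent: (i) π(a) = 0 for every *-representation (H, π) of A; (ii) ω(star a * a) = 0 for every positive linear functional ω on A; (iii) ω(a) = 0 for every positive linear functional ω on A. Consequently, the minimal closed *-ideal Jmin(A) (the intersection of all closed *-ideals of A) equals the intersection of the kernels of all positive linear functionals on A. -/
open scoped ComplexInnerProductSpace ComplexOrder

/-- A *-representation of a (possibly non-unital) *-algebra `A` over `ℂ` on a complex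
inner product space (pre-Hilbert space, not assumed complete). -/
structure StarRep (A : Type) [NonUnitalRing A] [Module ℂ A] [Star A] : Type 1 where
  carrier : Type
  [nacg : NormedAddCommGroup carrier]
  [ips : InnerProductSpace ℂ carrier]
  toFun : A → carrier →ₗ[ℂ] carrier
  map_add' : ∀ a b : A, toFun (a + b) = toFun a + toFun b
  map_smul' : ∀ (c : ℂ) (a : A), toFun (c • a) = c • toFun a
  map_mul' : ∀ a b : A, toFun (a * b) = toFun a ∘ₗ toFun b
  star_rep' : ∀ (a : A) (x y : carrier), ⟪toFun a x, y⟫ = ⟪x, toFun (star a) y⟫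

attribute [instance] StarRep.nacg StarRep.ips


/-- An approximate identity for a *-algebra `A` over `ℂ`: a filtration of `A` by
`ℂ`-submodules indexed by a directed partially ordered set, together with Hermitian elements
`E α` acting as units on the corresponding submodules. -/
structure ApproxIdentity (A : Type) [NonUnitalRing A] [Module ℂ A] [Star A] : Type 1 where
  ι : Type
  [po : PartialOrder ι]
  directed : ∀ α β : ι, ∃ γ : ι, α ≤ γ ∧ β ≤ γ
  sub : ι → Submodule ℂ A
  mono : ∀ {α β : ι}, α ≤ β → sub α ≤ sub β
  exhaustive : ∀ a : A, ∃ α : ι, a ∈ sub α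
  E : ι → A
  E_star : ∀ α : ι, star (E α) = E α
  E_mul_left : ∀ {α β : ι}, α < β → E α * E β = E α
  E_mul_right : ∀ {α β : ι}, α < β → E β * E α = E α
  E_unit_left : ∀ (α : ι), ∀ a ∈ sub α, E α * a = a
  E_unit_right : ∀ (α : ι), ∀ a ∈ sub α, a * E α = a

open scoped ComplexConjugate

namespace StarRep

section GNS

variable {A : Type} [NonUnitalRing A] [Module ℂ A] [SMulCommClass ℂ A A]
  [IsScalarTower ℂ A A] [StarRing A] [StarModule ℂ A]

/-- The sesquilinear form `(b, c) ↦ ω (star b * c)` of a linear functional `ω`. -/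
noncomputable def gnsForm (ω : A →ₗ[ℂ] ℂ) : A →ₗ⋆[ℂ] A →ₗ[ℂ] ℂ :=
  LinearMap.mk₂'ₛₗ (starRingEnd ℂ) (RingHom.id ℂ) (fun b c => ω (star b * c))
    (fun b b' c => by simp [add_mul])
    (fun r b c => by simp [smul_mul_assoc])
    (fun b c c' => by simp [mul_add])
    (fun r b c => by simp [mul_smul_comm])

theorem gnsForm_apply (ω : A →ₗ[ℂ] ℂ) (b c : A) : gnsForm ω b c = ω (star b * c) := rfl

variable {ω : A →ₗ[ℂ] ℂ}

theorem conj_gnsForm (hω : ∀ b : A, 0 ≤ ω (star b * b)) (b c : A) :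
    conj (gnsForm ω c b) = gnsForm ω b c := by
  have him (d : A) : (gnsForm ω d d).im = 0 := (Complex.le_def.1 (hω d)).2.symm
  have h₁ := him (b + c)
  have h₂ := him (b + Complex.I • c)
  have hb := him b
  have hc := him c
  simp only [map_add, LinearMap.add_apply, LinearMap.map_smulₛₗ, LinearMap.smul_apply,
    Complex.conj_I, RingHom.id_apply, smul_eq_mul, Complex.add_im, Complex.add_re, Complex.mul_im, Complex.mul_re,
    Complex.neg_im, Complex.neg_re, Complex.I_re, Complex.I_im] at h₁ h₂
  apply Complex.ext
  · rw [Complex.conj_re]; linarith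
  · rw [Complex.conj_im]; linarith

/-- The semi-inner product on `A` induced by a positive linear functional. -/
@[reducible]
noncomputable def gnsPreCore (hω : ∀ b : A, 0 ≤ ω (star b * b)) :
    PreInnerProductSpace.Core ℂ A where
  inner b c := gnsForm ω b c
  conj_inner_symm b c := conj_gnsForm hω b c
  re_inner_nonneg b := (Complex.le_def.1 (hω b)).1
  add_left b b' c := by simp
  smul_left b c r := by simp

theorem norm_gnsForm_sq_le (hω : ∀ b : A, 0 ≤ ω (star b * b)) (b c : A) :
    ‖gnsForm ω b c‖ ^ 2 ≤ (gnsForm ω b b).re * (gnsForm ω c c).re := by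
  have h : ‖gnsForm ω b c‖ * ‖gnsForm ω c b‖ ≤ (gnsForm ω b b).re * (gnsForm ω c c).re :=
    @InnerProductSpace.Core.inner_mul_inner_self_le ℂ A _ _ _ (gnsPreCore hω) b c
  rwa [← conj_gnsForm hω c b, RCLike.norm_conj, ← sq] at h

theorem gnsForm_eq_zero_of_right (hω : ∀ b : A, 0 ≤ ω (star b * b)) {c : A}
    (hc : gnsForm ω c c = 0) (b : A) : gnsForm ω b c = 0 := by
  have h := norm_gnsForm_sq_le hω b c
  rw [hc, Complex.zero_re, mul_zero] at h
  exact norm_eq_zero.1 (pow_eq_zero_iff two_ne_zero |>.1 (le_antisymm h (sq_nonneg _)))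

theorem mem_ker_gnsForm (hω : ∀ b : A, 0 ≤ ω (star b * b)) {c : A} :
    c ∈ LinearMap.ker (gnsForm ω) ↔ gnsForm ω c c = 0 := by
  refine ⟨fun h => by rw [LinearMap.mem_ker.1 h, LinearMap.zero_apply], fun h => ?_⟩
  ext b
  rw [← conj_gnsForm hω, gnsForm_eq_zero_of_right hω h, map_zero, LinearMap.zero_apply]

/-- The form induced by `gnsForm ω` on the quotient by the Gelfand ideal, in the first variable. -/
noncomputable def gnsLeft (ω : A →ₗ[ℂ] ℂ) :
    (A ⧸ LinearMap.ker (gnsForm ω)) →ₗ⋆[ℂ] A →ₗ[ℂ] ℂ :=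
  (LinearMap.ker (gnsForm ω)).liftQ (gnsForm ω) le_rfl

theorem ker_gnsForm_le_ker_gnsLeft (hω : ∀ b : A, 0 ≤ ω (star b * b))
    (x : A ⧸ LinearMap.ker (gnsForm ω)) :
    LinearMap.ker (gnsForm ω) ≤ LinearMap.ker (gnsLeft ω x) := by
  intro c hc
  obtain ⟨b, rfl⟩ := Submodule.Quotient.mk_surjective _ x
  exact gnsForm_eq_zero_of_right hω ((mem_ker_gnsForm hω).1 hc) b

/-- The inner product on the quotient of `A` by the Gelfand ideal of a positive functional. -/
@[reducible]
noncomputable def gnsCore (hω : ∀ b : A, 0 ≤ ω (star b * b)) :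
    InnerProductSpace.Core ℂ (A ⧸ LinearMap.ker (gnsForm ω)) where
  inner x y := (LinearMap.ker (gnsForm ω)).liftQ (gnsLeft ω x)
    (ker_gnsForm_le_ker_gnsLeft hω x) y
  conj_inner_symm x y := by
    obtain ⟨b, rfl⟩ := Submodule.Quotient.mk_surjective _ x
    obtain ⟨c, rfl⟩ := Submodule.Quotient.mk_surjective _ y
    exact conj_gnsForm hω b c
  re_inner_nonneg x := by
    obtain ⟨b, rfl⟩ := Submodule.Quotient.mk_surjective _ x
    exact (Complex.le_def.1 (hω b)).1
  add_left x x' y := by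
    obtain ⟨c, rfl⟩ := Submodule.Quotient.mk_surjective _ y
    simp
  smul_left x y r := by
    obtain ⟨c, rfl⟩ := Submodule.Quotient.mk_surjective _ y
    simp
  definite x hx := by
    obtain ⟨b, rfl⟩ := Submodule.Quotient.mk_surjective _ x
    exact (Submodule.Quotient.mk_eq_zero _).2 ((mem_ker_gnsForm hω).2 hx)

theorem ker_gnsForm_le_comap (hω : ∀ b : A, 0 ≤ ω (star b * b)) (a : A) :
    LinearMap.ker (gnsForm ω) ≤
      (LinearMap.ker (gnsForm ω)).comap (LinearMap.mulLeft ℂ a) := by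
  intro c hc
  rw [Submodule.mem_comap, mem_ker_gnsForm hω, LinearMap.mulLeft_apply, gnsForm_apply,
    star_mul, mul_assoc, ← gnsForm_apply, LinearMap.mem_ker.1 hc, LinearMap.zero_apply]

/-- The GNS representation of a positive linear functional on a *-algebra. -/
noncomputable def gns (hω : ∀ b : A, 0 ≤ ω (star b * b)) : StarRep A :=
  letI := (gnsCore hω).toNormedAddCommGroup
  letI := InnerProductSpace.ofCore (gnsCore hω).toCore
  { carrier := A ⧸ LinearMap.ker (gnsForm ω)
    toFun := fun a => Submodule.mapQ _ _ (LinearMap.mulLeft ℂ a) (ker_gnsForm_le_comap hω a)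
    map_add' := fun a b => by
      ext c
      exact congrArg (Submodule.Quotient.mk) (add_mul a b c)
    map_smul' := fun r a => by
      ext c
      exact congrArg (Submodule.Quotient.mk) (smul_mul_assoc r a c)
    map_mul' := fun a b => by
      ext c
      exact congrArg (Submodule.Quotient.mk) (mul_assoc a b c)
    star_rep' := fun a x y => by
      obtain ⟨b, rfl⟩ := Submodule.Quotient.mk_surjective _ x
      obtain ⟨c, rfl⟩ := Submodule.Quotient.mk_surjective _ y
      change ω (star (a * b) * c) = ω (star b * (star a * c))
      rw [star_mul, mul_assoc] }

theorem apply_star_mul_self_eq_zero_of_gns (hω : ∀ b : A, 0 ≤ ω (star b * b)) {a u : A}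
    (hu : a * u = a) (ha : (gns hω).toFun a = 0) : ω (star a * a) = 0 := by
  have h : (Submodule.Quotient.mk (a * u) : A ⧸ LinearMap.ker (gnsForm ω)) = 0 :=
    LinearMap.congr_fun ha (Submodule.Quotient.mk u)
  rw [hu, Submodule.Quotient.mk_eq_zero] at h
  exact (mem_ker_gnsForm hω).1 h

end GNS

variable {A : Type} [NonUnitalRing A] [Module ℂ A] [StarRing A]

/-- The linear functional `a ↦ ⟪x, π a x⟫` of a vector `x` of a *-representation. -/
noncomputable def vectorFunctional (R : StarRep A) (x : R.carrier) : A →ₗ[ℂ] ℂ where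
  toFun a := ⟪x, R.toFun a x⟫
  map_add' a b := by rw [R.map_add', LinearMap.add_apply, inner_add_right]
  map_smul' r a := by
    rw [R.map_smul', LinearMap.smul_apply, inner_smul_right, RingHom.id_apply, smul_eq_mul]

theorem vectorFunctional_star_mul_self_nonneg (R : StarRep A) (x : R.carrier) (b : A) :
    0 ≤ R.vectorFunctional x (star b * b) := by
  change 0 ≤ ⟪x, R.toFun (star b * b) x⟫
  rw [R.map_mul', LinearMap.comp_apply, ← R.star_rep', ← inner_self_ofReal_re,
    RCLike.ofReal_nonneg]
  exact inner_self_nonneg (𝕜 := ℂ)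

theorem toFun_eq_zero_of_vectorFunctional (R : StarRep A) {a : A}
    (h : ∀ x, R.vectorFunctional x a = 0) : R.toFun a = 0 := by
  refine (inner_map_self_eq_zero (R.toFun a)).1 fun x => ?_
  rw [← inner_conj_symm (𝕜 := ℂ) (R.toFun a x) x, show ⟪x, R.toFun a x⟫ = 0 from h x, map_zero]

end StarRep

/-- Let `A` be a *-algebra over `ℂ` with an approximate identity.  For
`a ∈ A` the following are equivalent: (i) `π a = 0` for every *-representation; (ii)
`ω (star a * a) = 0` for every positive linear functional; (iii) `ω a = 0` for every positive
linear functional.  Consequently the minimal closed *-ideal (the intersection of all closed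
*-ideals, i.e. of all kernels of *-representations) equals the intersection of the kernels of
all positive linear functionals. -/
theorem stmt12 {A : Type} [NonUnitalRing A] [Module ℂ A] [SMulCommClass ℂ A A]
    [IsScalarTower ℂ A A] [StarRing A] [StarModule ℂ A]
    (e : ApproxIdentity A) :
    (∀ a : A,
      ((∀ R : StarRep A, R.toFun a = 0) ↔
        (∀ ω : A →ₗ[ℂ] ℂ, (∀ b : A, 0 ≤ ω (star b * b)) → ω (star a * a) = 0)) ∧
      ((∀ ω : A →ₗ[ℂ] ℂ, (∀ b : A, 0 ≤ ω (star b * b)) → ω (star a * a) = 0) ↔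
        (∀ ω : A →ₗ[ℂ] ℂ, (∀ b : A, 0 ≤ ω (star b * b)) → ω a = 0))) ∧
    (⋂ I ∈ {I : Set A | ∃ R : StarRep A, I = {x : A | R.toFun x = 0}}, I) =
      {a : A | ∀ ω : A →ₗ[ℂ] ℂ, (∀ b : A, 0 ≤ ω (star b * b)) → ω a = 0} := by
  have rep_to_sq (a : A) (ha : ∀ R : StarRep A, R.toFun a = 0) (ω : A →ₗ[ℂ] ℂ)
      (hω : ∀ b : A, 0 ≤ ω (star b * b)) : ω (star a * a) = 0 := by
    obtain ⟨α, hα⟩ := e.exhaustive a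
    exact StarRep.apply_star_mul_self_eq_zero_of_gns hω (e.E_unit_right α a hα) (ha _)
  have sq_to_lin (a : A)
      (ha : ∀ ω : A →ₗ[ℂ] ℂ, (∀ b : A, 0 ≤ ω (star b * b)) → ω (star a * a) = 0)
      (ω : A →ₗ[ℂ] ℂ) (hω : ∀ b : A, 0 ≤ ω (star b * b)) : ω a = 0 := by
    obtain ⟨α, hα⟩ := e.exhaustive a
    have h := StarRep.gnsForm_eq_zero_of_right hω (ha ω hω) (e.E α)
    rwa [StarRep.gnsForm_apply, e.E_star, e.E_unit_left α a hα] at h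
  have lin_to_rep (a : A)
      (ha : ∀ ω : A →ₗ[ℂ] ℂ, (∀ b : A, 0 ≤ ω (star b * b)) → ω a = 0) (R : StarRep A) :
      R.toFun a = 0 :=
    R.toFun_eq_zero_of_vectorFunctional fun x =>
      ha _ (R.vectorFunctional_star_mul_self_nonneg x)
  refine ⟨fun a => ⟨⟨rep_to_sq a, fun h => lin_to_rep a (sq_to_lin a h)⟩,
    ⟨sq_to_lin a, fun h => rep_to_sq a (lin_to_rep a h)⟩⟩, ?_⟩
  ext a
  simp only [Set.mem_iInter, Set.mem_ofPred_eq]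
  refine ⟨fun h => sq_to_lin a (rep_to_sq a fun R => h _ ⟨R, rfl⟩), ?_⟩
  rintro h _ ⟨R, rfl⟩
  exact lin_to_rep a h R
end

section
/- Let A and B be *-algebras over ℂ and X a (B,A)-bimodule with compatible A-valued and B-valued inner products ⟨·,·⟩_A and ⟨·,·⟩_B. For a *-ideal I of A define Φ_X(I) := {b ∈ B : ⟨x, b·y⟩_A ∈ I for all x, y ∈ X}, and for a *-ideal J of B define Ψ_X(J) := {a ∈ A : ⟨x, y·(star a)⟩_B ∈ J for all x, y ∈ X}. Then for every *-ideal I of A and every a ∈ A: a ∈ Ψ_X(Φ_X(I)) if and only if ⟨x,y⟩_A * a * ⟨z,w⟩_A ∈ I for all x, y, z, w ∈ X. -/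
open scoped ComplexInnerProductSpace ComplexOrder

/-- A *-ideal of a *-algebra: a two-sided ideal closed under the involution. -/
def IsStarIdeal {A : Type} [NonUnitalRing A] [Star A] (I : Set A) : Prop :=
  (0 : A) ∈ I ∧ (∀ a ∈ I, ∀ b ∈ I, a + b ∈ I) ∧ (∀ a ∈ I, -a ∈ I) ∧
    (∀ a ∈ I, ∀ b : A, a * b ∈ I ∧ b * a ∈ I) ∧ (∀ a ∈ I, star a ∈ I)

/-- For a `(B,A)`-bimodule `X` with compatible `A`- and `B`-valued
inner products, and a *-ideal `I` of `A`: `a ∈ Ψ_X(Φ_X(I))` iff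
`⟨x,y⟩_A * a * ⟨z,w⟩_A ∈ I` for all `x, y, z, w ∈ X`. -/
theorem stmt15 {A B : Type}
    [NonUnitalRing A] [Module ℂ A] [SMulCommClass ℂ A A] [IsScalarTower ℂ A A]
    [StarRing A] [StarModule ℂ A]
    [NonUnitalRing B] [Module ℂ B] [SMulCommClass ℂ B B] [IsScalarTower ℂ B B]
    [StarRing B] [StarModule ℂ B]
    -- a `(B,A)`-bimodule `X`:
    (X : Type) [AddCommGroup X] [Module ℂ X]
    (lsmul : B → X → X) (rsmul : X → A → X)
    (lsmul_add : ∀ (b : B) (x y : X), lsmul b (x + y) = lsmul b x + lsmul b y)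
    (add_lsmul : ∀ (b b' : B) (x : X), lsmul (b + b') x = lsmul b x + lsmul b' x)
    (lsmul_smul : ∀ (c : ℂ) (b : B) (x : X), lsmul (c • b) x = c • lsmul b x)
    (smul_lsmul : ∀ (c : ℂ) (b : B) (x : X), lsmul b (c • x) = c • lsmul b x)
    (lsmul_mul : ∀ (b b' : B) (x : X), lsmul (b * b') x = lsmul b (lsmul b' x))
    (rsmul_add : ∀ (x y : X) (a : A), rsmul (x + y) a = rsmul x a + rsmul y a)
    (add_rsmul : ∀ (x : X) (a a' : A), rsmul x (a + a') = rsmul x a + rsmul x a')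
    (rsmul_smul : ∀ (c : ℂ) (x : X) (a : A), rsmul (c • x) a = c • rsmul x a)
    (smul_rsmul : ∀ (c : ℂ) (x : X) (a : A), rsmul x (c • a) = c • rsmul x a)
    (rsmul_mul : ∀ (x : X) (a a' : A), rsmul x (a * a') = rsmul (rsmul x a) a')
    (lsmul_rsmul : ∀ (b : B) (x : X) (a : A), rsmul (lsmul b x) a = lsmul b (rsmul x a))
    -- an `A`-valued inner product on `X` with compatible `B`-action:
    (ipA : X → X → A)
    (ipA_add : ∀ x y z : X, ipA x (y + z) = ipA x y + ipA x z)
    (ipA_smul : ∀ (c : ℂ) (x y : X), ipA x (c • y) = c • ipA x y)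
    (ipA_rsmul : ∀ (x y : X) (a : A), ipA x (rsmul y a) = ipA x y * a)
    (ipA_star : ∀ x y : X, ipA x y = star (ipA y x))
    (ipA_compat : ∀ (b : B) (x y : X), ipA (lsmul b x) y = ipA x (lsmul (star b) y))
    -- a `B`-valued inner product on `X` with compatible `A`-action:
    (ipB : X → X → B)
    (ipB_add : ∀ x y z : X, ipB (x + y) z = ipB x z + ipB y z)
    (ipB_smul : ∀ (c : ℂ) (x y : X), ipB (c • x) y = c • ipB x y)
    (ipB_lsmul : ∀ (b : B) (x y : X), ipB (lsmul b x) y = b * ipB x y)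
    (ipB_star : ∀ x y : X, ipB x y = star (ipB y x))
    (ipB_compat : ∀ (x y : X) (a : A), ipB (rsmul x a) y = ipB x (rsmul y (star a)))
    -- compatibility of the two inner products:
    (ip_compat : ∀ x y z : X, rsmul x (ipA y z) = lsmul (ipB x y) z)
    (I : Set A) (hI : IsStarIdeal I) (a : A) :
    (∀ x y : X, ipB x (rsmul y (star a)) ∈
        {b : B | ∀ x' y' : X, ipA x' (lsmul b y') ∈ I}) ↔
      (∀ x y z w : X, ipA x y * a * ipA z w ∈ I) := by
  have key (x y z w : X) :
      ipA x (lsmul (ipB y (rsmul z (star a))) w) = ipA x y * a * ipA z w := by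
    rw [← ipB_compat, ← ip_compat, ipA_rsmul, ipA_rsmul]
  simp only [Set.mem_ofPred_eq, key]
  exact ⟨fun h x y z w => h y z x w, fun h y z x w => h x y z w⟩
end

section
/- Let A and B be *-algebras over ℂ, both with approximate identities, and let X be a (B,A)-bimodule with compatible full A-valued and B-valued inner products ⟨·,·⟩_A and ⟨·,·⟩_B. Define Φ_X(I) := {b ∈ B : ⟨x, b·y⟩_A ∈ I for all x, y ∈ X} for *-ideals I of A and Ψ_X(J) := {a ∈ A : ⟨x, y·(star a)⟩_B ∈ J for all x, y ∈ X} for *-ideals J of B. Then Ψ_X(Φ_X(I)) = I for every *-ideal I of A and Φ_X(Ψ_X(J)) = J for every *-ideal J of B; in particular Φ_X is an inclusion-preserving bijection from the *-ideals of A onto the *-ideals of B, with inverse Ψ_X. -/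
open scoped ComplexInnerProductSpace ComplexOrder

/-- In the presence of an approximate identity, a *-ideal is a complex subspace. -/
theorem IsStarIdeal.smul_mem {R : Type} [NonUnitalRing R] [Module ℂ R] [IsScalarTower ℂ R R]
    [Star R] (e : ApproxIdentity R) {I : Set R} (hI : IsStarIdeal I) (c : ℂ) {a : R}
    (ha : a ∈ I) : c • a ∈ I := by
  obtain ⟨α, hα⟩ := e.exhaustive a
  have h := (hI.2.2.2.1 a ha (c • e.E α)).2
  rwa [smul_mul_assoc, e.E_unit_left α a hα] at h

/-- If `s * a * t` lies in a *-ideal for all `s`, `t` in a spanning set, then so does `a`. -/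
theorem IsStarIdeal.mem_of_mul_mul_mem {R : Type} [NonUnitalRing R] [Module ℂ R]
    [SMulCommClass ℂ R R] [IsScalarTower ℂ R R] [Star R] (e : ApproxIdentity R) {I : Set R}
    (hI : IsStarIdeal I) {S : Set R} (hS : Submodule.span ℂ S = ⊤) {a : R}
    (h : ∀ s ∈ S, ∀ t ∈ S, s * a * t ∈ I) : a ∈ I := by
  have h_right : ∀ s ∈ S, ∀ t : R, s * a * t ∈ I := by
    intro s hs t
    have ht : t ∈ Submodule.span ℂ S := hS ▸ Submodule.mem_top
    induction ht using Submodule.span_induction with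
    | mem t ht => exact h s hs t ht
    | zero => simpa using hI.1
    | add t u _ _ iht ihu => simpa [mul_add] using hI.2.1 _ iht _ ihu
    | smul c t _ iht => simpa [mul_smul_comm] using hI.smul_mem e c iht
  have h_both : ∀ s t : R, s * a * t ∈ I := by
    intro s t
    have hs : s ∈ Submodule.span ℂ S := hS ▸ Submodule.mem_top
    induction hs using Submodule.span_induction with
    | mem s hs => exact h_right s hs t
    | zero => simpa using hI.1
    | add s u _ _ ihs ihu => simpa [add_mul] using hI.2.1 _ ihs _ ihu
    | smul c s _ ihs => simpa [smul_mul_assoc] using hI.smul_mem e c ihs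
  obtain ⟨α, hα⟩ := e.exhaustive a
  simpa [e.E_unit_left α a hα, e.E_unit_right α a hα] using h_both (e.E α) (e.E α)

/-- Let `A`, `B` be *-algebras over `ℂ` with approximate identities and
`X` a `(B,A)`-bimodule with compatible **full** `A`- and `B`-valued inner products.  Then
`Ψ_X ∘ Φ_X = id` on *-ideals of `A` and `Φ_X ∘ Ψ_X = id` on *-ideals of `B`; in
particular `Φ_X` is an inclusion-preserving bijection from the *-ideals of `A` onto the
*-ideals of `B`. -/
theorem stmt16 {A B : Type}
    [NonUnitalRing A] [Module ℂ A] [SMulCommClass ℂ A A] [IsScalarTower ℂ A A]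
    [StarRing A] [StarModule ℂ A]
    [NonUnitalRing B] [Module ℂ B] [SMulCommClass ℂ B B] [IsScalarTower ℂ B B]
    [StarRing B] [StarModule ℂ B]
    (eA : ApproxIdentity A) (eB : ApproxIdentity B)
    -- a `(B,A)`-bimodule `X`:
    (X : Type) [AddCommGroup X] [Module ℂ X]
    (lsmul : B → X → X) (rsmul : X → A → X)
    (lsmul_add : ∀ (b : B) (x y : X), lsmul b (x + y) = lsmul b x + lsmul b y)
    (add_lsmul : ∀ (b b' : B) (x : X), lsmul (b + b') x = lsmul b x + lsmul b' x)
    (lsmul_smul : ∀ (c : ℂ) (b : B) (x : X), lsmul (c • b) x = c • lsmul b x)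
    (smul_lsmul : ∀ (c : ℂ) (b : B) (x : X), lsmul b (c • x) = c • lsmul b x)
    (lsmul_mul : ∀ (b b' : B) (x : X), lsmul (b * b') x = lsmul b (lsmul b' x))
    (rsmul_add : ∀ (x y : X) (a : A), rsmul (x + y) a = rsmul x a + rsmul y a)
    (add_rsmul : ∀ (x : X) (a a' : A), rsmul x (a + a') = rsmul x a + rsmul x a')
    (rsmul_smul : ∀ (c : ℂ) (x : X) (a : A), rsmul (c • x) a = c • rsmul x a)
    (smul_rsmul : ∀ (c : ℂ) (x : X) (a : A), rsmul x (c • a) = c • rsmul x a)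
    (rsmul_mul : ∀ (x : X) (a a' : A), rsmul x (a * a') = rsmul (rsmul x a) a')
    (lsmul_rsmul : ∀ (b : B) (x : X) (a : A), rsmul (lsmul b x) a = lsmul b (rsmul x a))
    -- an `A`-valued inner product on `X` with compatible `B`-action:
    (ipA : X → X → A)
    (ipA_add : ∀ x y z : X, ipA x (y + z) = ipA x y + ipA x z)
    (ipA_smul : ∀ (c : ℂ) (x y : X), ipA x (c • y) = c • ipA x y)
    (ipA_rsmul : ∀ (x y : X) (a : A), ipA x (rsmul y a) = ipA x y * a)
    (ipA_star : ∀ x y : X, ipA x y = star (ipA y x))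
    (ipA_compat : ∀ (b : B) (x y : X), ipA (lsmul b x) y = ipA x (lsmul (star b) y))
    -- a `B`-valued inner product on `X` with compatible `A`-action:
    (ipB : X → X → B)
    (ipB_add : ∀ x y z : X, ipB (x + y) z = ipB x z + ipB y z)
    (ipB_smul : ∀ (c : ℂ) (x y : X), ipB (c • x) y = c • ipB x y)
    (ipB_lsmul : ∀ (b : B) (x y : X), ipB (lsmul b x) y = b * ipB x y)
    (ipB_star : ∀ x y : X, ipB x y = star (ipB y x))
    (ipB_compat : ∀ (x y : X) (a : A), ipB (rsmul x a) y = ipB x (rsmul y (star a)))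
    -- compatibility of the two inner products:
    (ip_compat : ∀ x y z : X, rsmul x (ipA y z) = lsmul (ipB x y) z)
    -- fullness of both inner products:
    (fullA : Submodule.span ℂ {c : A | ∃ x y : X, c = ipA x y} = ⊤)
    (fullB : Submodule.span ℂ {c : B | ∃ x y : X, c = ipB x y} = ⊤) :
    (∀ I : Set A, IsStarIdeal I →
      {a : A | ∀ x y : X, ipB x (rsmul y (star a)) ∈
        {b : B | ∀ x' y' : X, ipA x' (lsmul b y') ∈ I}} = I) ∧
    (∀ J : Set B, IsStarIdeal J →
      {b : B | ∀ x y : X, ipA x (lsmul b y) ∈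
        {a : A | ∀ x' y' : X, ipB x' (rsmul y' (star a)) ∈ J}} = J) ∧
    (∀ I I' : Set A, IsStarIdeal I → IsStarIdeal I' → I ⊆ I' →
      {b : B | ∀ x y : X, ipA x (lsmul b y) ∈ I} ⊆ {b : B | ∀ x y : X, ipA x (lsmul b y) ∈ I'}) ∧
    Set.BijOn (fun I : Set A => {b : B | ∀ x y : X, ipA x (lsmul b y) ∈ I})
      {I : Set A | IsStarIdeal I} {J : Set B | IsStarIdeal J} := by
  have ipA_rsmul_left : ∀ (x y : X) (a : A), ipA (rsmul x a) y = star a * ipA x y := by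
    intro x y a
    rw [ipA_star, ipA_rsmul, star_mul, ← ipA_star]
  have ipB_lsmul_right : ∀ (x y : X) (b : B), ipB x (lsmul b y) = ipB x y * star b := by
    intro x y b
    rw [ipB_star, ipB_lsmul, star_mul, ← ipB_star]
  have ipA_sandwich : ∀ (a : A) (x y x' y' : X),
      ipA x' (lsmul (ipB x (rsmul y (star a))) y') = ipA x' x * a * ipA y y' := by
    intro a x y x' y'
    rw [← ip_compat, ipA_rsmul, ipA_rsmul_left, star_star, mul_assoc]
  have ipB_sandwich : ∀ (b : B) (x y x' y' : X),
      ipB x' (rsmul y' (star (ipA x (lsmul b y)))) = ipB x' x * b * ipB y y' := by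
    intro b x y x' y'
    rw [← ipA_star, ip_compat, ipB_lsmul_right, ← ipB_star, ipB_lsmul, mul_assoc]
  have psi_phi : ∀ I : Set A, IsStarIdeal I →
      {a : A | ∀ x y : X, ipB x (rsmul y (star a)) ∈
        {b : B | ∀ x' y' : X, ipA x' (lsmul b y') ∈ I}} = I := by
    intro I hI
    ext a
    simp only [Set.mem_ofPred_eq, ipA_sandwich]
    refine ⟨fun h => hI.mem_of_mul_mul_mem eA fullA ?_, fun h x y x' y' =>
      (hI.2.2.2.1 _ (hI.2.2.2.1 _ h _).2 _).1⟩
    rintro _ ⟨x', x, rfl⟩ _ ⟨y, y', rfl⟩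
    exact h x y x' y'
  have phi_psi : ∀ J : Set B, IsStarIdeal J →
      {b : B | ∀ x y : X, ipA x (lsmul b y) ∈
        {a : A | ∀ x' y' : X, ipB x' (rsmul y' (star a)) ∈ J}} = J := by
    intro J hJ
    ext b
    simp only [Set.mem_ofPred_eq, ipB_sandwich]
    refine ⟨fun h => hJ.mem_of_mul_mul_mem eB fullB ?_, fun h x y x' y' =>
      (hJ.2.2.2.1 _ (hJ.2.2.2.1 _ h _).2 _).1⟩
    rintro _ ⟨x', x, rfl⟩ _ ⟨y, y', rfl⟩
    exact h x y x' y'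
  have phi_ideal : ∀ I : Set A, IsStarIdeal I →
      IsStarIdeal {b : B | ∀ x y : X, ipA x (lsmul b y) ∈ I} := by
    rintro I ⟨h_zero, h_add, h_neg, -, h_star⟩
    have add_map (x y : X) (b b' : B) :
        ipA x (lsmul (b + b') y) = ipA x (lsmul b y) + ipA x (lsmul b' y) := by
      rw [add_lsmul, ipA_add]
    let f (x y : X) : B →+ A := AddMonoidHom.mk' (fun b => ipA x (lsmul b y)) (add_map x y)
    refine ⟨fun x y => ?_, fun b hb b' hb' x y => ?_, fun b hb x y => ?_,
      fun b hb c => ⟨fun x y => ?_, fun x y => ?_⟩, fun b hb x y => ?_⟩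
    · exact (congrArg (· ∈ I) (map_zero (f x y))).mpr h_zero
    · exact add_map x y b b' ▸ h_add _ (hb x y) _ (hb' x y)
    · exact (congrArg (· ∈ I) (map_neg (f x y) b)).mpr (h_neg _ (hb x y))
    · rw [lsmul_mul]
      exact hb x (lsmul c y)
    · rw [lsmul_mul, ← star_star c, ← ipA_compat]
      exact hb (lsmul (star c) x) y
    · rw [← ipA_compat, ipA_star]
      exact h_star _ (hb y x)
  have psi_ideal : ∀ J : Set B, IsStarIdeal J →
      IsStarIdeal {a : A | ∀ x y : X, ipB x (rsmul y (star a)) ∈ J} := by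
    rintro J ⟨h_zero, h_add, h_neg, -, h_star⟩
    have add_map (x y : X) (a a' : A) : ipB x (rsmul y (star (a + a'))) =
        ipB x (rsmul y (star a)) + ipB x (rsmul y (star a')) := by
      simp only [← ipB_compat, add_rsmul, ipB_add]
    let f (x y : X) : A →+ B :=
      AddMonoidHom.mk' (fun a => ipB x (rsmul y (star a))) (add_map x y)
    refine ⟨fun x y => ?_, fun a ha a' ha' x y => ?_, fun a ha x y => ?_,
      fun a ha c => ⟨fun x y => ?_, fun x y => ?_⟩, fun a ha x y => ?_⟩
    · exact (congrArg (· ∈ J) (map_zero (f x y))).mpr h_zero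
    · exact add_map x y a a' ▸ h_add _ (ha x y) _ (ha' x y)
    · exact (congrArg (· ∈ J) (map_neg (f x y) a)).mpr (h_neg _ (ha x y))
    · rw [star_mul, rsmul_mul]
      exact ha x (rsmul y (star c))
    · rw [star_mul, rsmul_mul, ← ipB_compat]
      exact ha (rsmul x c) y
    · rw [← ipB_compat, ipB_star]
      exact h_star _ (ha y x)
  refine ⟨psi_phi, phi_psi, fun I I' _ _ hII' b hb x y => hII' (hb x y), phi_ideal, ?_, ?_⟩
  · intro I hI I' hI' h
    rw [← psi_phi I hI, ← psi_phi I' hI']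
    exact congrArg (fun J : Set B => {a : A | ∀ x y : X, ipB x (rsmul y (star a)) ∈ J}) h
  · exact fun J hJ => ⟨_, psi_ideal J hJ, phi_psi J hJ⟩
end

section
/- Let A and B be idempotent *-algebras over ℂ (products span the algebra over ℂ) and let X be a (B,A)-equivalence bimodule. Define Φ_X(I) := {b ∈ B : ⟨x, b·y⟩_A ∈ I for all x, y ∈ X} and Ψ_X(J) := {a ∈ A : ⟨x, y·(star a)⟩_B ∈ J for all x, y ∈ X}. Then Φ_X maps closed *-ideals of A to closed *-ideals of B, Ψ_X maps closed *-ideals of B to closed *-ideals of A, and Ψ_X(Φ_X(I)) = I, Φ_X(Ψ_X(J)) = J hold for all closed *-ideals I of A and J of B; thus Φ_X is an inclusion-preserving bijection between the closed *-ideals of A and those of B, i.e. the lattices of closed *-ideals of A and B are isomorphic. -/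
open scoped ComplexInnerProductSpace ComplexOrder

/-- A `(B,A)`-equivalence bimodule between *-algebras over `ℂ`: a `(B,A)`-bimodule with
full, positive, compatible `A`- and `B`-valued inner products satisfying properties P and Q. -/
structure EquivBimodule (B A : Type)
    [NonUnitalRing A] [Module ℂ A] [SMulCommClass ℂ A A] [IsScalarTower ℂ A A]
    [StarRing A] [StarModule ℂ A]
    [NonUnitalRing B] [Module ℂ B] [SMulCommClass ℂ B B] [IsScalarTower ℂ B B]
    [StarRing B] [StarModule ℂ B] : Type 1 where
  X : Type
  [xgrp : AddCommGroup X]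
  [xmod : Module ℂ X]
  lsmul : B → X → X
  rsmul : X → A → X
  lsmul_add : ∀ (b : B) (x y : X), lsmul b (x + y) = lsmul b x + lsmul b y
  add_lsmul : ∀ (b b' : B) (x : X), lsmul (b + b') x = lsmul b x + lsmul b' x
  lsmul_smul : ∀ (c : ℂ) (b : B) (x : X), lsmul (c • b) x = c • lsmul b x
  smul_lsmul : ∀ (c : ℂ) (b : B) (x : X), lsmul b (c • x) = c • lsmul b x
  lsmul_mul : ∀ (b b' : B) (x : X), lsmul (b * b') x = lsmul b (lsmul b' x)
  rsmul_add : ∀ (x y : X) (a : A), rsmul (x + y) a = rsmul x a + rsmul y a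
  add_rsmul : ∀ (x : X) (a a' : A), rsmul x (a + a') = rsmul x a + rsmul x a'
  rsmul_smul : ∀ (c : ℂ) (x : X) (a : A), rsmul (c • x) a = c • rsmul x a
  smul_rsmul : ∀ (c : ℂ) (x : X) (a : A), rsmul x (c • a) = c • rsmul x a
  rsmul_mul : ∀ (x : X) (a a' : A), rsmul x (a * a') = rsmul (rsmul x a) a'
  lsmul_rsmul : ∀ (b : B) (x : X) (a : A), rsmul (lsmul b x) a = lsmul b (rsmul x a)
  ipA : X → X → A
  ipA_add : ∀ x y z : X, ipA x (y + z) = ipA x y + ipA x z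
  ipA_smul : ∀ (c : ℂ) (x y : X), ipA x (c • y) = c • ipA x y
  ipA_rsmul : ∀ (x y : X) (a : A), ipA x (rsmul y a) = ipA x y * a
  ipA_star : ∀ x y : X, ipA x y = star (ipA y x)
  ipA_compat : ∀ (b : B) (x y : X), ipA (lsmul b x) y = ipA x (lsmul (star b) y)
  ipB : X → X → B
  ipB_add : ∀ x y z : X, ipB (x + y) z = ipB x z + ipB y z
  ipB_smul : ∀ (c : ℂ) (x y : X), ipB (c • x) y = c • ipB x y
  ipB_lsmul : ∀ (b : B) (x y : X), ipB (lsmul b x) y = b * ipB x y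
  ipB_star : ∀ x y : X, ipB x y = star (ipB y x)
  ipB_compat : ∀ (x y : X) (a : A), ipB (rsmul x a) y = ipB x (rsmul y (star a))
  ip_compat : ∀ x y z : X, rsmul x (ipA y z) = lsmul (ipB x y) z
  fullA : Submodule.span ℂ {c : A | ∃ x y : X, c = ipA x y} = ⊤
  fullB : Submodule.span ℂ {c : B | ∃ x y : X, c = ipB x y} = ⊤
  posA : ∀ (ω : A →ₗ[ℂ] ℂ), (∀ a : A, 0 ≤ ω (star a * a)) → ∀ x : X, 0 ≤ ω (ipA x x)
  posB : ∀ (ω : B →ₗ[ℂ] ℂ), (∀ b : B, 0 ≤ ω (star b * b)) → ∀ x : X, 0 ≤ ω (ipB x x)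
  propP : ∀ (R : StarRep A) (n : ℕ) (x : Fin n → X) (φ : Fin n → R.carrier),
    0 ≤ ∑ i, ∑ j, ⟪φ i, R.toFun (ipA (x i) (x j)) (φ j)⟫
  propQ : ∀ (S : StarRep B) (n : ℕ) (x : Fin n → X) (ψ : Fin n → S.carrier),
    0 ≤ ∑ i, ∑ j, ⟪ψ i, S.toFun (ipB (x i) (x j)) (ψ j)⟫

/-- A closed *-ideal: the kernel of some *-representation. -/
def IsClosedStarIdeal {A : Type} [NonUnitalRing A] [Module ℂ A] [Star A] (I : Set A) : Prop :=
  ∃ R : StarRep A, I = {a : A | R.toFun a = 0}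

namespace StarRep

variable {A : Type} [NonUnitalRing A] [Module ℂ A] [StarRing A] (R : StarRep A)

/-- The linear map underlying a *-representation. -/
def toLin : A →ₗ[ℂ] (R.carrier →ₗ[ℂ] R.carrier) where
  toFun := R.toFun
  map_add' := R.map_add'
  map_smul' := R.map_smul'

lemma toFun_eq_zero_of_star_mul_self {a : A} (h : R.toFun (star a * a) = 0) :
    R.toFun a = 0 := by
  ext x
  have h1 := R.star_rep' a x (R.toFun a x)
  rw [← LinearMap.comp_apply, ← R.map_mul', h] at h1
  simpa using h1

lemma toFun_star_eq_zero {a : A} (h : R.toFun a = 0) : R.toFun (star a) = 0 := by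
  apply R.toFun_eq_zero_of_star_mul_self
  rw [star_star, R.map_mul', h, LinearMap.zero_comp]

lemma toFun_eq_zero_of_forall_mul_mul {a : A} (h : ∀ b c, R.toFun (b * a * c) = 0) :
    R.toFun a = 0 := by
  have h1 : R.toFun (a * star a) = 0 := by
    apply R.toFun_eq_zero_of_star_mul_self
    rw [star_mul, ← mul_assoc, star_star, mul_assoc a, ← mul_assoc]
    simpa [mul_assoc] using h (a * star a) (star a)
  have h2 : R.toFun (star a) = 0 :=
    R.toFun_eq_zero_of_star_mul_self (by rwa [star_star])
  simpa using R.toFun_star_eq_zero h2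

end StarRep

/-- If a set spans `A`, sandwiching by its elements detects membership in a closed *-ideal. -/
lemma StarRep.toFun_eq_zero_iff_of_span_eq_top {A : Type} [NonUnitalRing A] [Module ℂ A]
    [SMulCommClass ℂ A A] [IsScalarTower ℂ A A] [StarRing A] (R : StarRep A) {s : Set A}
    (hs : Submodule.span ℂ s = ⊤) (a : A) :
    R.toFun a = 0 ↔ ∀ b ∈ s, ∀ c ∈ s, R.toFun (b * a * c) = 0 := by
  constructor
  · intro h b _ c _
    rw [R.map_mul', R.map_mul', h, LinearMap.comp_zero, LinearMap.zero_comp]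
  · intro h
    apply R.toFun_eq_zero_of_forall_mul_mul
    have h1 : ∀ b ∈ s, ∀ c, R.toFun (b * a * c) = 0 := by
      intro b hb c
      have : (⊤ : Submodule ℂ A) ≤ LinearMap.ker (R.toLin ∘ₗ LinearMap.mulLeft ℂ (b * a)) := by
        rw [← hs, Submodule.span_le]
        exact fun c hc => h b hb c hc
      exact this (Submodule.mem_top (x := c))
    intro b c
    have : (⊤ : Submodule ℂ A) ≤ LinearMap.ker (R.toLin ∘ₗ LinearMap.mulRight ℂ (a * c)) := by
      rw [← hs, Submodule.span_le]
      intro b hb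
      change R.toFun (b * (a * c)) = 0
      rw [← mul_assoc]
      exact h1 b hb c
    have h2 : R.toFun (b * (a * c)) = 0 := this (Submodule.mem_top (x := b))
    rwa [← mul_assoc] at h2

lemma inseparable_iff_forall_inner {V : Type} [SeminormedAddCommGroup V] [InnerProductSpace ℂ V]
    {x y : V} : Inseparable x y ↔ ∀ z : V, ⟪z, x⟫ = ⟪z, y⟫ := by
  constructor
  · intro h z
    exact (h.map (f := fun w : V => ⟪z, w⟫) (by fun_prop)).eq
  · intro h
    rw [Metric.inseparable_iff, dist_eq_norm]
    have h1 : ⟪x - y, x - y⟫ = 0 := by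
      rw [inner_sub_right, h, sub_self]
    have h2 := norm_sq_eq_re_inner (𝕜 := ℂ) (x - y)
    rw [h1] at h2
    simpa using h2

/-- A *-representation up to null vectors on a semi-inner product space descends to the
separation quotient, so its kernel is a closed *-ideal. -/
lemma isClosedStarIdeal_of_seminormed {B : Type} [NonUnitalRing B] [Module ℂ B] [Star B]
    {V : Type} [SeminormedAddCommGroup V] [InnerProductSpace ℂ V] (T : B → V →ₗ[ℂ] V)
    (hadd : ∀ b b' x y, ⟪x, T (b + b') y⟫ = ⟪x, T b y⟫ + ⟪x, T b' y⟫)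
    (hsmul : ∀ (c : ℂ) b x y, ⟪x, T (c • b) y⟫ = c * ⟪x, T b y⟫)
    (hmul : ∀ b b' x y, ⟪x, T (b * b') y⟫ = ⟪x, T b (T b' y)⟫)
    (hstar : ∀ b x y, ⟪T b x, y⟫ = ⟪x, T (star b) y⟫)
    (hstar' : ∀ b x y, ⟪T (star b) x, y⟫ = ⟪x, T b y⟫) :
    IsClosedStarIdeal {b : B | ∀ x y : V, ⟪x, T b y⟫ = 0} := by
  have hwd : ∀ b (x y : V), Inseparable x y →
      SeparationQuotient.mk (T b x) = SeparationQuotient.mk (T b y) := by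
    intro b x y h
    rw [SeparationQuotient.mk_eq_mk, inseparable_iff_forall_inner]
    intro z
    rw [← hstar', ← hstar', inseparable_iff_forall_inner.1 h]
  let Q : B → SeparationQuotient V →ₗ[ℂ] SeparationQuotient V := fun b =>
    { toFun := SeparationQuotient.lift (fun x => SeparationQuotient.mk (T b x)) (hwd b)
      map_add' := by
        intro x y
        obtain ⟨x, rfl⟩ := SeparationQuotient.surjective_mk x
        obtain ⟨y, rfl⟩ := SeparationQuotient.surjective_mk y
        simp [← SeparationQuotient.mk_add]
      map_smul' := by
        intro c x
        obtain ⟨x, rfl⟩ := SeparationQuotient.surjective_mk x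
        simp [← SeparationQuotient.mk_smul] }
  have hQ : ∀ b x, Q b (SeparationQuotient.mk x) = SeparationQuotient.mk (T b x) := fun _ _ => rfl
  refine ⟨{ carrier := SeparationQuotient V
            toFun := Q
            map_add' := ?_
            map_smul' := ?_
            map_mul' := ?_
            star_rep' := ?_ }, ?_⟩
  · intro b b'
    ext x
    obtain ⟨x, rfl⟩ := SeparationQuotient.surjective_mk x
    rw [LinearMap.add_apply, hQ, hQ, hQ, ← SeparationQuotient.mk_add,
      SeparationQuotient.mk_eq_mk, inseparable_iff_forall_inner]
    intro z
    rw [hadd, inner_add_right]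
  · intro c b
    ext x
    obtain ⟨x, rfl⟩ := SeparationQuotient.surjective_mk x
    rw [LinearMap.smul_apply, hQ, hQ, ← SeparationQuotient.mk_smul,
      SeparationQuotient.mk_eq_mk, inseparable_iff_forall_inner]
    intro z
    rw [hsmul, inner_smul_right]
  · intro b b'
    ext x
    obtain ⟨x, rfl⟩ := SeparationQuotient.surjective_mk x
    rw [LinearMap.comp_apply, hQ, hQ, hQ, SeparationQuotient.mk_eq_mk,
      inseparable_iff_forall_inner]
    intro z
    rw [hmul]
  · intro b x y
    obtain ⟨x, rfl⟩ := SeparationQuotient.surjective_mk x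
    obtain ⟨y, rfl⟩ := SeparationQuotient.surjective_mk y
    rw [hQ, hQ, SeparationQuotient.inner_mk_mk, SeparationQuotient.inner_mk_mk, hstar]
  · ext b
    constructor
    · intro h
      change Q b = 0
      refine LinearMap.ext fun x => ?_
      obtain ⟨x, rfl⟩ := SeparationQuotient.surjective_mk x
      rw [hQ, LinearMap.zero_apply, ← SeparationQuotient.mk_zero,
        SeparationQuotient.mk_eq_mk, inseparable_iff_forall_inner]
      intro z
      rw [h, inner_zero_right]
    · intro h x y
      have h : Q b = 0 := h
      rw [← SeparationQuotient.inner_mk_mk, ← hQ, h, LinearMap.zero_apply, inner_zero_right]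

namespace StarRep

variable {A : Type} [NonUnitalRing A] [Module ℂ A] [StarRing A] (R : StarRep A)
  {X : Type} (k : X → X → A)

/-- The sesquilinear form on finitely supported functions induced by an `A`-valued kernel. -/
noncomputable def kernelForm (f g : X →₀ R.carrier) : ℂ :=
  f.sum fun x φ => g.sum fun y ψ => ⟪φ, R.toFun (k x y) ψ⟫

lemma kernelForm_add_left (f f' g : X →₀ R.carrier) :
    R.kernelForm k (f + f') g = R.kernelForm k f g + R.kernelForm k f' g :=
  Finsupp.sum_add_index' (by simp) (by simp [Finsupp.sum_add])

lemma kernelForm_add_right (f g g' : X →₀ R.carrier) :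
    R.kernelForm k f (g + g') = R.kernelForm k f g + R.kernelForm k f g' := by
  unfold kernelForm
  rw [← Finsupp.sum_add]
  exact Finsupp.sum_congr fun x _ =>
    Finsupp.sum_add_index' (by simp) (by simp)

lemma kernelForm_single_single (x y : X) (φ ψ : R.carrier) :
    R.kernelForm k (Finsupp.single x φ) (Finsupp.single y ψ) = ⟪φ, R.toFun (k x y) ψ⟫ := by
  simp [kernelForm]

/-- Biadditive functions on finitely supported functions agree if they agree on singles. -/
lemma finsupp_biadditive_ext {H M : Type*} [AddCommGroup H] [AddCommGroup M]
    {S T : (X →₀ H) → (X →₀ H) → M}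
    (hSl : ∀ f f' g, S (f + f') g = S f g + S f' g)
    (hSr : ∀ f g g', S f (g + g') = S f g + S f g')
    (hTl : ∀ f f' g, T (f + f') g = T f g + T f' g)
    (hTr : ∀ f g g', T f (g + g') = T f g + T f g')
    (h : ∀ x φ y ψ, S (Finsupp.single x φ) (Finsupp.single y ψ) =
      T (Finsupp.single x φ) (Finsupp.single y ψ)) (f g : X →₀ H) : S f g = T f g := by
  have hz : ∀ {U : (X →₀ H) → (X →₀ H) → M},
      (∀ f f' g, U (f + f') g = U f g + U f' g) → ∀ g, U 0 g = 0 := by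
    intro U hU g
    simpa using hU 0 0 g
  have hz' : ∀ {U : (X →₀ H) → (X →₀ H) → M},
      (∀ f g g', U f (g + g') = U f g + U f g') → ∀ f, U f 0 = 0 := by
    intro U hU f
    simpa using hU f 0 0
  induction f using Finsupp.induction_linear with
  | zero => rw [hz hSl, hz hTl]
  | add f f' hf hf' => rw [hSl, hTl, hf, hf']
  | single x φ =>
    induction g using Finsupp.induction_linear with
    | zero => rw [hz' hSr, hz' hTr]
    | add g g' hg hg' => rw [hSr, hTr, hg, hg']
    | single y ψ => exact h x φ y ψ

lemma kernelForm_self_nonneg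
    (hpos : ∀ (n : ℕ) (x : Fin n → X) (φ : Fin n → R.carrier),
      0 ≤ ∑ i, ∑ j, ⟪φ i, R.toFun (k (x i) (x j)) (φ j)⟫) (f : X →₀ R.carrier) :
    0 ≤ R.kernelForm k f f := by
  let e := f.support.equivFin
  have h := hpos _ (fun i => (e.symm i : X)) (fun i => f (e.symm i))
  have hsum : ∀ F : X → ℂ, ∑ i, F (e.symm i) = ∑ x ∈ f.support, F x := fun F => by
    rw [Equiv.sum_comp e.symm (fun x : f.support => F x), Finset.sum_coe_sort]
  have h2 : R.kernelForm k f f = ∑ i, ∑ j, ⟪f (e.symm i),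
      R.toFun (k (e.symm i) (e.symm j)) (f (e.symm j))⟫ := by
    rw [hsum fun x => ∑ j, ⟪f x, R.toFun (k x (e.symm j)) (f (e.symm j))⟫]
    exact Finset.sum_congr rfl fun x _ => (hsum fun y => ⟪f x, R.toFun (k x y) (f y)⟫).symm
  rwa [h2]

lemma conj_kernelForm (hk : ∀ x y, k x y = star (k y x)) (f g : X →₀ R.carrier) :
    (starRingEnd ℂ) (R.kernelForm k g f) = R.kernelForm k f g := by
  refine finsupp_biadditive_ext (S := fun f g => (starRingEnd ℂ) (R.kernelForm k g f)) ?_ ?_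
    (R.kernelForm_add_left k) (R.kernelForm_add_right k) ?_ f g
  · simp [kernelForm_add_right]
  · simp [kernelForm_add_left]
  · intro x φ y ψ
    simp only [kernelForm_single_single]
    rw [inner_conj_symm, R.star_rep', ← hk]

lemma kernelForm_smul_left (c : ℂ) (f g : X →₀ R.carrier) :
    R.kernelForm k (c • f) g = (starRingEnd ℂ) c * R.kernelForm k f g := by
  refine finsupp_biadditive_ext (S := fun f g => R.kernelForm k (c • f) g)
    (T := fun f g => (starRingEnd ℂ) c * R.kernelForm k f g) ?_ ?_ ?_ ?_ ?_ f g
  · simp [kernelForm_add_left]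
  · simp [kernelForm_add_right]
  · simp [kernelForm_add_left, mul_add]
  · simp [kernelForm_add_right, mul_add]
  · simp [kernelForm_single_single, mul_comm]

/-- A positive Hermitian kernel gives a semi-inner product on finitely supported functions. -/
noncomputable abbrev kernelCore (hk : ∀ x y, k x y = star (k y x))
    (hpos : ∀ (n : ℕ) (x : Fin n → X) (φ : Fin n → R.carrier),
      0 ≤ ∑ i, ∑ j, ⟪φ i, R.toFun (k (x i) (x j)) (φ j)⟫) :
    PreInnerProductSpace.Core ℂ (X →₀ R.carrier) where
  inner := R.kernelForm k
  conj_inner_symm f g := R.conj_kernelForm k hk f g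
  re_inner_nonneg f := (Complex.nonneg_iff.1 (R.kernelForm_self_nonneg k hpos f)).1
  add_left := R.kernelForm_add_left k
  smul_left f g c := R.kernelForm_smul_left k c f g

/-- The kernel of the representation induced along a positive Hermitian kernel. -/
lemma isClosedStarIdeal_of_kernel {B : Type} [NonUnitalRing B] [Module ℂ B] [StarRing B]
    (hk : ∀ x y, k x y = star (k y x))
    (hpos : ∀ (n : ℕ) (x : Fin n → X) (φ : Fin n → R.carrier),
      0 ≤ ∑ i, ∑ j, ⟪φ i, R.toFun (k (x i) (x j)) (φ j)⟫)
    (act : B → X → X)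
    (hadd : ∀ b b' x y, k x (act (b + b') y) = k x (act b y) + k x (act b' y))
    (hsmul : ∀ (c : ℂ) b x y, k x (act (c • b) y) = c • k x (act b y))
    (hmul : ∀ b b' x y, k x (act (b * b') y) = k x (act b (act b' y)))
    (hstar : ∀ b x y, k (act b x) y = k x (act (star b) y)) :
    IsClosedStarIdeal {b : B | ∀ x y, k x (act b y) ∈ {a | R.toFun a = 0}} := by
  let core := R.kernelCore k hk hpos
  let _ : SeminormedAddCommGroup (X →₀ R.carrier) :=
    InnerProductSpace.Core.toSeminormedAddCommGroup (𝕜 := ℂ)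
  let _ : InnerProductSpace ℂ (X →₀ R.carrier) := InnerProductSpace.ofCore core
  have hin : ∀ f g : X →₀ R.carrier, ⟪f, g⟫ = R.kernelForm k f g := fun _ _ => rfl
  let T : B → (X →₀ R.carrier) →ₗ[ℂ] (X →₀ R.carrier) :=
    fun b => Finsupp.lmapDomain R.carrier ℂ (act b)
  have hT : ∀ b x φ, T b (Finsupp.single x φ) = Finsupp.single (act b x) φ :=
    fun b x φ => Finsupp.mapDomain_single
  have hst : ∀ b f g, ⟪T b f, g⟫ = ⟪f, T (star b) g⟫ := by
    intro b
    refine finsupp_biadditive_ext ?_ ?_ ?_ ?_ ?_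
    · simp [inner_add_left]
    · simp [inner_add_right]
    · simp [inner_add_left]
    · simp [inner_add_right]
    · intro x φ y ψ
      rw [hT, hT, hin, hin, kernelForm_single_single, kernelForm_single_single, hstar]
  have key := isClosedStarIdeal_of_seminormed T ?_ ?_ ?_ hst
    (fun b f g => by rw [hst, star_star])
  · convert key using 1
    ext b
    constructor
    · intro h
      refine finsupp_biadditive_ext (S := fun f g => ⟪f, T b g⟫) (T := fun _ _ => (0 : ℂ))
        ?_ ?_ ?_ ?_ ?_
      · simp [inner_add_left]
      · simp [inner_add_right]
      · simp
      · simp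
      · intro x φ y ψ
        rw [hT, hin, kernelForm_single_single, h x y]
        simp
    · intro h x y
      refine LinearMap.ext fun ψ => ext_inner_left ℂ fun φ => ?_
      have := h (Finsupp.single x φ) (Finsupp.single y ψ)
      rw [hT, hin, kernelForm_single_single] at this
      simpa using this
  · intro b b'
    refine finsupp_biadditive_ext (S := fun f g => ⟪f, T (b + b') g⟫)
      (T := fun f g => ⟪f, T b g⟫ + ⟪f, T b' g⟫) ?_ ?_ ?_ ?_ ?_
    · simp [inner_add_left]
    · simp [inner_add_right]
    · intro f f' g
      simp only [inner_add_left]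
      ring
    · intro f g g'
      simp only [inner_add_right, map_add]
      ring
    · intro x φ y ψ
      simp only [hT, hin, kernelForm_single_single]
      rw [hadd, R.map_add', LinearMap.add_apply, inner_add_right]
  · intro c b
    refine finsupp_biadditive_ext (S := fun f g => ⟪f, T (c • b) g⟫)
      (T := fun f g => c * ⟪f, T b g⟫) ?_ ?_ ?_ ?_ ?_
    · simp [inner_add_left]
    · simp [inner_add_right]
    · simp [inner_add_left, mul_add]
    · simp [inner_add_right, mul_add]
    · intro x φ y ψ
      simp only [hT, hin, kernelForm_single_single]
      rw [hsmul, R.map_smul', LinearMap.smul_apply, inner_smul_right]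
  · intro b b'
    refine finsupp_biadditive_ext (S := fun f g => ⟪f, T (b * b') g⟫)
      (T := fun f g => ⟪f, T b (T b' g)⟫) ?_ ?_ ?_ ?_ ?_
    · simp [inner_add_left]
    · simp [inner_add_right]
    · simp [inner_add_left]
    · simp [inner_add_right]
    · intro x φ y ψ
      simp only [hT, hin, kernelForm_single_single]
      rw [hmul]

end StarRep

namespace EquivBimodule

variable {A B : Type}
    [NonUnitalRing A] [Module ℂ A] [SMulCommClass ℂ A A] [IsScalarTower ℂ A A]
    [StarRing A] [StarModule ℂ A]
    [NonUnitalRing B] [Module ℂ B] [SMulCommClass ℂ B B] [IsScalarTower ℂ B B]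
    [StarRing B] [StarModule ℂ B] (E : EquivBimodule B A)

attribute [local instance] EquivBimodule.xgrp EquivBimodule.xmod

lemma ipA_rsmul_left (x y : E.X) (a : A) : E.ipA (E.rsmul x a) y = star a * E.ipA x y := by
  rw [E.ipA_star, E.ipA_rsmul, star_mul, ← E.ipA_star]

lemma ipB_lsmul_right (x y : E.X) (b : B) : E.ipB x (E.lsmul b y) = E.ipB x y * star b := by
  rw [E.ipB_star, E.ipB_lsmul, star_mul, ← E.ipB_star]

lemma ipB_add_right (x y z : E.X) : E.ipB x (y + z) = E.ipB x y + E.ipB x z := by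
  rw [E.ipB_star, E.ipB_add, star_add, ← E.ipB_star, ← E.ipB_star]

lemma ipB_smul_right (c : ℂ) (x y : E.X) : E.ipB x (c • y) = star c • E.ipB x y := by
  rw [E.ipB_star, E.ipB_smul, star_smul, ← E.ipB_star]

lemma ipA_lsmul_ipB (x y x' y' : E.X) (a : A) :
    E.ipA x' (E.lsmul (E.ipB x (E.rsmul y (star a))) y') = E.ipA x' x * a * E.ipA y y' := by
  rw [← E.ip_compat, E.ipA_rsmul, ipA_rsmul_left, star_star, mul_assoc]

lemma ipB_rsmul_star_ipA (x y x' y' : E.X) (b : B) :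
    E.ipB x' (E.rsmul y' (star (E.ipA x (E.lsmul b y)))) = E.ipB x' x * b * E.ipB y y' := by
  rw [← E.ipA_star, E.ip_compat, ipB_lsmul_right, ← E.ipB_star, E.ipB_lsmul, mul_assoc]

lemma isClosedStarIdeal_phi {I : Set A} (hI : IsClosedStarIdeal I) :
    IsClosedStarIdeal {b : B | ∀ x y : E.X, E.ipA x (E.lsmul b y) ∈ I} := by
  obtain ⟨R, rfl⟩ := hI
  refine R.isClosedStarIdeal_of_kernel E.ipA E.ipA_star (E.propP R) E.lsmul ?_ ?_ ?_ E.ipA_compat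
  · intro b b' x y
    rw [E.add_lsmul, E.ipA_add]
  · intro c b x y
    rw [E.lsmul_smul, E.ipA_smul]
  · intro b b' x y
    rw [E.lsmul_mul]

lemma isClosedStarIdeal_psi {J : Set B} (hJ : IsClosedStarIdeal J) :
    IsClosedStarIdeal {a : A | ∀ x y : E.X, E.ipB x (E.rsmul y (star a)) ∈ J} := by
  obtain ⟨S, rfl⟩ := hJ
  refine S.isClosedStarIdeal_of_kernel E.ipB E.ipB_star (E.propQ S)
    (fun a y => E.rsmul y (star a)) ?_ ?_ ?_ ?_
  · intro a a' x y
    rw [star_add, E.add_rsmul, ipB_add_right]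
  · intro c a x y
    rw [star_smul, E.smul_rsmul, ipB_smul_right, star_star]
  · intro a a' x y
    rw [star_mul, E.rsmul_mul]
  · intro a x y
    rw [E.ipB_compat]

lemma psi_phi {I : Set A} (hI : IsClosedStarIdeal I) :
    {a : A | ∀ x y : E.X, E.ipB x (E.rsmul y (star a)) ∈
      {b : B | ∀ x' y' : E.X, E.ipA x' (E.lsmul b y') ∈ I}} = I := by
  obtain ⟨R, rfl⟩ := hI
  ext a
  simp only [Set.mem_ofPred_eq, ipA_lsmul_ipB]
  rw [R.toFun_eq_zero_iff_of_span_eq_top E.fullA]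
  constructor
  · rintro h _ ⟨x', x, rfl⟩ _ ⟨y, y', rfl⟩
    exact h x y x' y'
  · intro h x y x' y'
    exact h _ ⟨x', x, rfl⟩ _ ⟨y, y', rfl⟩

lemma phi_psi {J : Set B} (hJ : IsClosedStarIdeal J) :
    {b : B | ∀ x y : E.X, E.ipA x (E.lsmul b y) ∈
      {a : A | ∀ x' y' : E.X, E.ipB x' (E.rsmul y' (star a)) ∈ J}} = J := by
  obtain ⟨S, rfl⟩ := hJ
  ext b
  simp only [Set.mem_ofPred_eq, ipB_rsmul_star_ipA]
  rw [S.toFun_eq_zero_iff_of_span_eq_top E.fullB]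
  constructor
  · rintro h _ ⟨x', x, rfl⟩ _ ⟨y, y', rfl⟩
    exact h x y x' y'
  · intro h x y x' y'
    exact h _ ⟨x', x, rfl⟩ _ ⟨y, y', rfl⟩

end EquivBimodule

/-- Let `A`, `B` be idempotent *-algebras over `ℂ` and `E` a
`(B,A)`-equivalence bimodule.  Then `Φ_X` maps closed *-ideals of `A` to closed *-ideals of
`B`, `Ψ_X` maps closed *-ideals of `B` to closed *-ideals of `A`, these maps are mutually
inverse and inclusion-preserving; hence the lattices of closed *-ideals of `A` and `B` are
isomorphic. -/
theorem stmt17 {A B : Type}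
    [NonUnitalRing A] [Module ℂ A] [SMulCommClass ℂ A A] [IsScalarTower ℂ A A]
    [StarRing A] [StarModule ℂ A]
    [NonUnitalRing B] [Module ℂ B] [SMulCommClass ℂ B B] [IsScalarTower ℂ B B]
    [StarRing B] [StarModule ℂ B]
    (hAidem : Submodule.span ℂ {c : A | ∃ a b : A, c = a * b} = ⊤)
    (hBidem : Submodule.span ℂ {c : B | ∃ a b : B, c = a * b} = ⊤)
    (E : EquivBimodule B A) :
    (∀ I : Set A, IsClosedStarIdeal I →
      IsClosedStarIdeal {b : B | ∀ x y : E.X, E.ipA x (E.lsmul b y) ∈ I}) ∧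
    (∀ J : Set B, IsClosedStarIdeal J →
      IsClosedStarIdeal {a : A | ∀ x y : E.X, E.ipB x (E.rsmul y (star a)) ∈ J}) ∧
    (∀ I : Set A, IsClosedStarIdeal I →
      {a : A | ∀ x y : E.X, E.ipB x (E.rsmul y (star a)) ∈
        {b : B | ∀ x' y' : E.X, E.ipA x' (E.lsmul b y') ∈ I}} = I) ∧
    (∀ J : Set B, IsClosedStarIdeal J →
      {b : B | ∀ x y : E.X, E.ipA x (E.lsmul b y) ∈
        {a : A | ∀ x' y' : E.X, E.ipB x' (E.rsmul y' (star a)) ∈ J}} = J) ∧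
    (∀ I I' : Set A, IsClosedStarIdeal I → IsClosedStarIdeal I' → I ⊆ I' →
      {b : B | ∀ x y : E.X, E.ipA x (E.lsmul b y) ∈ I} ⊆
        {b : B | ∀ x y : E.X, E.ipA x (E.lsmul b y) ∈ I'}) ∧
    Set.BijOn (fun I : Set A => {b : B | ∀ x y : E.X, E.ipA x (E.lsmul b y) ∈ I})
      {I : Set A | IsClosedStarIdeal I} {J : Set B | IsClosedStarIdeal J} := by
  refine ⟨fun I => E.isClosedStarIdeal_phi, fun J => E.isClosedStarIdeal_psi,
    fun I => E.psi_phi, fun J => E.phi_psi, fun I I' _ _ h b hb x y => h (hb x y), ?_⟩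
  exact Set.InvOn.bijOn
    (f' := fun J : Set B => {a : A | ∀ x y : E.X, E.ipB x (E.rsmul y (star a)) ∈ J})
    ⟨fun I hI => E.psi_phi hI, fun J hJ => E.phi_psi hJ⟩
    (fun I hI => E.isClosedStarIdeal_phi hI) (fun J hJ => E.isClosedStarIdeal_psi hJ)
end

section
/- Let A and B be non-degenerate, idempotent *-algebras over ℂ that are formally Morita equivalent (there exists a (B,A)-equivalence bimodule). Then A admits a faithful *-representation-like separation, i.e. {a ∈ A : π(a) = 0 for every *-representation (H, π) of A} = {0}, if and only if {b ∈ B : ρ(b) = 0 for every *-representation (K, ρ) of B} = {0}. Equivalently, the minimal closed *-ideal of A is trivial if and only if the minimal closed *-ideal of B is trivial. -/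
open scoped ComplexInnerProductSpace ComplexOrder

section Separation

open SeparationQuotient in
/-- A family of (possibly unbounded) operators on a semi-inner-product space which is
a *-representation up to null vectors descends to a *-representation on the quotient. -/
theorem exists_starRep_of_seminormed {B V : Type} [NonUnitalRing B] [Module ℂ B] [StarRing B]
    [SeminormedAddCommGroup V] [InnerProductSpace ℂ V] (T : B → V →ₗ[ℂ] V)
    (hadd : ∀ b b' u v, ⟪u, T (b + b') v⟫ = ⟪u, T b v⟫ + ⟪u, T b' v⟫)
    (hsmul : ∀ (c : ℂ) b u v, ⟪u, T (c • b) v⟫ = c * ⟪u, T b v⟫)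
    (hmul : ∀ b b' u v, ⟪u, T (b * b') v⟫ = ⟪u, T b (T b' v)⟫)
    (hstar : ∀ b u v, ⟪T b u, v⟫ = ⟪u, T (star b) v⟫) :
    ∃ S : StarRep B, ∀ b, S.toFun b = 0 → ∀ u v, ⟪u, T b v⟫ = 0 := by
  let p : V →ₗ[ℂ] SeparationQuotient V := (mkCLM ℂ V).toLinearMap
  have hp : Function.Surjective p := surjective_mk
  have hin : ∀ u v, ⟪p u, p v⟫ = ⟪u, v⟫ := fun u v => inner_mk_mk u v
  have hext : ∀ {x y : SeparationQuotient V}, (∀ u, ⟪p u, x⟫ = ⟪p u, y⟫) → x = y := by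
    intro x y h
    refine ext_inner_left ℂ fun w => ?_
    obtain ⟨u, rfl⟩ := hp w
    exact h u
  have hker : ∀ b, LinearMap.ker p ≤ LinearMap.ker (p ∘ₗ T b) := by
    intro b v hv
    rw [LinearMap.mem_ker] at hv ⊢
    refine hext fun u => ?_
    rw [LinearMap.comp_apply, hin, ← star_star b, ← hstar, ← hin, hv, inner_zero_right, inner_zero_right]
  let S : B → SeparationQuotient V →ₗ[ℂ] SeparationQuotient V := fun b =>
    (LinearMap.ker p).liftQ (p ∘ₗ T b) (hker b) ∘ₗ
      (p.quotKerEquivOfSurjective hp).symm.toLinearMap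
  have hS : ∀ b v, S b (p v) = p (T b v) := by
    intro b v
    have : (p.quotKerEquivOfSurjective hp).symm (p v) = (LinearMap.ker p).mkQ v := by
      rw [LinearEquiv.symm_apply_eq]; rfl
    simp [S, this]
  refine ⟨⟨SeparationQuotient V, S, ?_, ?_, ?_, ?_⟩, ?_⟩
  · intro a b
    ext x
    obtain ⟨v, rfl⟩ := hp x
    refine hext fun u => ?_
    simp only [LinearMap.add_apply, hS, inner_add_right, hin, hadd]
  · intro c a
    ext x
    obtain ⟨v, rfl⟩ := hp x
    refine hext fun u => ?_
    simp only [LinearMap.smul_apply, hS, inner_smul_right, hin, hsmul]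
  · intro a b
    ext x
    obtain ⟨v, rfl⟩ := hp x
    refine hext fun u => ?_
    simp only [LinearMap.comp_apply, hS, hin, hmul]
  · intro a x y
    obtain ⟨u, rfl⟩ := hp x
    obtain ⟨v, rfl⟩ := hp y
    simp only [hS, hin, hstar]
  · intro b hb u v
    have hb : S b = 0 := hb
    rw [← hin, ← hS, hb, LinearMap.zero_apply, inner_zero_right]

variable {A B X : Type} [NonUnitalRing A] [Module ℂ A] [StarRing A]

/-- The sesquilinear form `⟪x ⊗ φ, y ⊗ ψ⟫ = ⟪φ, π(⟨x, y⟩) ψ⟫` on the free sum of copies of the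
representation space indexed by `X`. -/
noncomputable def inducedForm (R : StarRep A) (ip : X → X → A) (f g : X →₀ R.carrier) : ℂ :=
  f.sum fun x φ => g.sum fun y ψ => ⟪φ, R.toFun (ip x y) ψ⟫

theorem inducedForm_eq_sum (R : StarRep A) (ip : X → X → A) (f g : X →₀ R.carrier)
    {s t : Finset X} (hs : f.support ⊆ s) (ht : g.support ⊆ t) :
    inducedForm R ip f g = ∑ x ∈ s, ∑ y ∈ t, ⟪f x, R.toFun (ip x y) (g y)⟫ := by
  unfold inducedForm
  rw [Finsupp.sum_of_support_subset f hs _ (by simp)]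
  refine Finset.sum_congr rfl fun x _ => ?_
  rw [Finsupp.sum_of_support_subset g ht _ (by simp)]

theorem inducedForm_add_left (R : StarRep A) (ip : X → X → A) (f f' g : X →₀ R.carrier) :
    inducedForm R ip (f + f') g = inducedForm R ip f g + inducedForm R ip f' g := by
  classical
  unfold inducedForm
  rw [Finsupp.sum_add_index']
  · simp
  · intro x φ φ'
    simp [Finsupp.sum_add]

theorem inducedForm_single (R : StarRep A) (ip : X → X → A) (x y : X) (φ ψ : R.carrier) :
    inducedForm R ip (.single x φ) (.single y ψ) = ⟪φ, R.toFun (ip x y) ψ⟫ := by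
  simp [inducedForm]

/-- The induced form is positive semidefinite when `ip` is hermitian and completely positive
with respect to `R`. -/
noncomputable abbrev inducedCore (R : StarRep A) (ip : X → X → A)
    (hherm : ∀ x y, ip x y = star (ip y x))
    (hpos : ∀ (n : ℕ) (x : Fin n → X) (φ : Fin n → R.carrier),
      0 ≤ ∑ i, ∑ j, ⟪φ i, R.toFun (ip (x i) (x j)) (φ j)⟫) :
    PreInnerProductSpace.Core ℂ (X →₀ R.carrier) where
  inner := inducedForm R ip
  conj_inner_symm f g := by
    change (starRingEnd ℂ) (inducedForm R ip g f) = inducedForm R ip f g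
    rw [inducedForm_eq_sum R ip g f subset_rfl subset_rfl,
      inducedForm_eq_sum R ip f g subset_rfl subset_rfl, Finset.sum_comm]
    simp only [map_sum, inner_conj_symm]
    refine Finset.sum_congr rfl fun x _ => Finset.sum_congr rfl fun y _ => ?_
    rw [R.star_rep', ← hherm]
  re_inner_nonneg f := by
    change 0 ≤ (inducedForm R ip f f).re
    rw [inducedForm_eq_sum R ip f f subset_rfl subset_rfl]
    have e := f.support.equivFin.symm
    have h := hpos _ (fun i => (e i : X)) (fun i => f (e i))
    have key : ∀ F : X → ℂ, ∑ i, F (e i) = ∑ x ∈ f.support, F x := fun F => by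
      rw [← Finset.sum_coe_sort f.support F]
      exact e.sum_comp (fun x : f.support => F x)
    rw [← key, Finset.sum_congr rfl fun i _ => (key _).symm]
    exact (Complex.le_def.1 h).1
  add_left := inducedForm_add_left R ip
  smul_left f g c := by
    change inducedForm R ip (c • f) g = _ * inducedForm R ip f g
    rw [inducedForm_eq_sum R ip (c • f) g Finsupp.support_smul subset_rfl,
      inducedForm_eq_sum R ip f g subset_rfl subset_rfl]
    simp only [Finsupp.smul_apply, inner_smul_left, Finset.mul_sum]

/-- Rieffel induction along a set `X` carrying an action of `B` and a completely positive
`A`-valued inner product. -/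
theorem exists_induced_starRep [NonUnitalRing B] [Module ℂ B] [StarRing B] (R : StarRep A)
    (ip : X → X → A) (L : B → X → X)
    (hherm : ∀ x y, ip x y = star (ip y x))
    (hpos : ∀ (n : ℕ) (x : Fin n → X) (φ : Fin n → R.carrier),
      0 ≤ ∑ i, ∑ j, ⟪φ i, R.toFun (ip (x i) (x j)) (φ j)⟫)
    (hadd : ∀ b b' x y, ip x (L (b + b') y) = ip x (L b y) + ip x (L b' y))
    (hsmul : ∀ (c : ℂ) b x y, ip x (L (c • b) y) = c • ip x (L b y))
    (hmul : ∀ b b' y, L (b * b') y = L b (L b' y))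
    (hstar : ∀ b x y, ip (L b x) y = ip x (L (star b) y)) :
    ∃ S : StarRep B, ∀ b, S.toFun b = 0 → ∀ x y, R.toFun (ip x (L b y)) = 0 := by
  let : SeminormedAddCommGroup (X →₀ R.carrier) :=
    @InnerProductSpace.Core.toSeminormedAddCommGroup ℂ _ _ _ _ (inducedCore R ip hherm hpos)
  let : InnerProductSpace ℂ (X →₀ R.carrier) :=
    InnerProductSpace.ofCore (inducedCore R ip hherm hpos)
  have hin : ∀ f g : X →₀ R.carrier, ⟪f, g⟫ = inducedForm R ip f g := fun _ _ => rfl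
  let T : B → (X →₀ R.carrier) →ₗ[ℂ] (X →₀ R.carrier) := fun b =>
    Finsupp.lmapDomain R.carrier ℂ (L b)
  have hT : ∀ b x φ, T b (.single x φ) = .single (L b x) φ := fun b x φ => by
    simp [T, Finsupp.lmapDomain_apply, Finsupp.mapDomain_single]
  have hstarT : ∀ b u v, ⟪T b u, v⟫ = ⟪u, T (star b) v⟫ := by
    intro b u v
    induction u using Finsupp.induction_linear with
    | zero => simp
    | add u u' h h' => rw [map_add, inner_add_left, inner_add_left, h, h']
    | single x φ =>
      induction v using Finsupp.induction_linear with
      | zero => simp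
      | add v v' h h' => rw [map_add, inner_add_right, inner_add_right, h, h']
      | single y ψ => simp only [hT, hin, inducedForm_single, hstar]
  suffices ∃ S : StarRep B, ∀ b, S.toFun b = 0 → ∀ u v, ⟪u, T b v⟫ = 0 by
    obtain ⟨S, hS⟩ := this
    refine ⟨S, fun b hb x y => LinearMap.ext fun ψ => ext_inner_left ℂ fun φ => ?_⟩
    have := hS b hb (.single x φ) (.single y ψ)
    rwa [hT, hin, inducedForm_single, ← inner_zero_right φ] at this
  refine exists_starRep_of_seminormed T ?_ ?_ ?_ hstarT
  · intro b b' u v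
    induction u using Finsupp.induction_linear with
    | zero => simp
    | add u u' h h' => simp only [inner_add_left, h, h']; ring
    | single x φ =>
      induction v using Finsupp.induction_linear with
      | zero => simp
      | add v v' h h' => simp only [map_add, inner_add_right, h, h']; ring
      | single y ψ =>
        simp only [hT, hin, inducedForm_single, hadd, R.map_add', LinearMap.add_apply,
          inner_add_right]
  · intro c b u v
    induction u using Finsupp.induction_linear with
    | zero => simp
    | add u u' h h' => simp only [inner_add_left, h, h']; ring
    | single x φ =>
      induction v using Finsupp.induction_linear with
      | zero => simp
      | add v v' h h' => simp only [map_add, inner_add_right, h, h']; ring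
      | single y ψ =>
        simp only [hT, hin, inducedForm_single, hsmul, R.map_smul', LinearMap.smul_apply,
          inner_smul_right]
  · intro b b' u v
    have : T (b * b') = T b ∘ₗ T b' := by
      refine Finsupp.lhom_ext fun x φ => ?_
      rw [LinearMap.comp_apply, hT, hT, hT, hmul]
    rw [this, LinearMap.comp_apply]

end Separation

/-- In a non-degenerate algebra, an element is zero if its two-sided products with
a spanning set vanish. -/
theorem eq_zero_of_span_eq_top {A : Type} [NonUnitalRing A] [Module ℂ A] [SMulCommClass ℂ A A]
    [IsScalarTower ℂ A A]
    (hnd : ∀ a : A, ((∀ a' : A, a * a' = 0) → a = 0) ∧ ((∀ a' : A, a' * a = 0) → a = 0))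
    {s : Set A} (hs : Submodule.span ℂ s = ⊤) {a : A} (h : ∀ p ∈ s, ∀ q ∈ s, p * a * q = 0) :
    a = 0 := by
  have hmem : ∀ p : A, p ∈ Submodule.span ℂ s := fun p => hs ▸ Submodule.mem_top
  refine (hnd a).2 fun p => (hnd _).1 fun q => ?_
  induction hmem p using Submodule.span_induction with
  | zero => simp
  | add p p' _ _ hp hp' => simp [add_mul, hp, hp']
  | smul c p _ hp => simp [smul_mul_assoc, hp]
  | mem p hp =>
    induction hmem q using Submodule.span_induction with
    | zero => simp
    | add q q' _ _ hq hq' => simp [mul_add, hq, hq']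
    | smul c q _ hq => simp [mul_smul_comm, hq]
    | mem q hq => exact h p hp q hq

/-- Let `A`, `B` be non-degenerate idempotent *-algebras over `ℂ` which are
formally Morita equivalent.  Then the elements of `A` killed by every *-representation reduce
to `{0}` if and only if the same holds for `B`; i.e. `Jmin A` is trivial iff `Jmin B` is. -/
theorem stmt18 {A B : Type}
    [NonUnitalRing A] [Module ℂ A] [SMulCommClass ℂ A A] [IsScalarTower ℂ A A]
    [StarRing A] [StarModule ℂ A]
    [NonUnitalRing B] [Module ℂ B] [SMulCommClass ℂ B B] [IsScalarTower ℂ B B]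
    [StarRing B] [StarModule ℂ B]
    (hAnd : ∀ a : A, ((∀ a' : A, a * a' = 0) → a = 0) ∧ ((∀ a' : A, a' * a = 0) → a = 0))
    (hBnd : ∀ b : B, ((∀ b' : B, b * b' = 0) → b = 0) ∧ ((∀ b' : B, b' * b = 0) → b = 0))
    (hAidem : Submodule.span ℂ {c : A | ∃ a b : A, c = a * b} = ⊤)
    (hBidem : Submodule.span ℂ {c : B | ∃ a b : B, c = a * b} = ⊤)
    (hme : Nonempty (EquivBimodule B A)) :
    ({a : A | ∀ R : StarRep A, R.toFun a = 0} = {0}) ↔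
      ({b : B | ∀ S : StarRep B, S.toFun b = 0} = {0}) := by
  obtain ⟨E⟩ := hme
  let := E.xgrp
  let := E.xmod
  have ipA_zero : ∀ x, E.ipA x 0 = 0 := fun x => by simpa using E.ipA_smul 0 x 0
  have ipB_zero : ∀ x, E.ipB 0 x = 0 := fun x => by simpa using E.ipB_smul 0 0 x
  have rsmul_zero : ∀ x, E.rsmul x 0 = 0 := fun x => by simpa using E.smul_rsmul 0 x 0
  have zero_lsmul : ∀ x, E.lsmul 0 x = 0 := fun x => by simpa using E.lsmul_smul 0 0 x
  have rsmul_ipA : ∀ x y a, E.ipA (E.rsmul x (star a)) y = a * E.ipA x y := fun x y a => by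
    rw [E.ipA_star, E.ipA_rsmul, star_mul, star_star, ← E.ipA_star]
  have ipB_add_right : ∀ x y z, E.ipB x (y + z) = E.ipB x y + E.ipB x z := fun x y z => by
    rw [E.ipB_star, E.ipB_add, star_add, ← E.ipB_star, ← E.ipB_star]
  have ipB_smul_right : ∀ (c : ℂ) x y, E.ipB x (star c • y) = c • E.ipB x y := fun c x y => by
    rw [E.ipB_star, E.ipB_smul, star_smul, star_star, ← E.ipB_star]
  simp only [Set.eq_singleton_iff_unique_mem, Set.mem_ofPred_eq]
  constructor
  · rintro ⟨-, hA⟩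
    refine ⟨fun S => by simpa using S.map_smul' 0 0, fun b hb => ?_⟩
    have hz : ∀ x y, E.ipA x (E.lsmul b y) = 0 := fun x y => hA _ fun R => by
      obtain ⟨S, hS⟩ := exists_induced_starRep R E.ipA E.lsmul E.ipA_star (E.propP R)
        (fun b b' x y => by rw [E.add_lsmul, E.ipA_add])
        (fun c b x y => by rw [E.lsmul_smul, E.ipA_smul]) E.lsmul_mul E.ipA_compat
      exact hS b (hb S) x y
    refine eq_zero_of_span_eq_top hBnd E.fullB ?_
    rintro _ ⟨z, x, rfl⟩ _ ⟨y, w, rfl⟩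
    rw [mul_assoc, ← E.ipB_lsmul, ← E.ipB_lsmul, ← E.ip_compat, hz, rsmul_zero, ipB_zero]
  · rintro ⟨-, hB⟩
    refine ⟨fun R => by simpa using R.map_smul' 0 0, fun a ha => ?_⟩
    have hz : ∀ x y, E.ipB x (E.rsmul y (star a)) = 0 := fun x y => hB _ fun S => by
      obtain ⟨R, hR⟩ := exists_induced_starRep S E.ipB (fun a x => E.rsmul x (star a))
        E.ipB_star (E.propQ S)
        (fun b b' x y => by rw [star_add, E.add_rsmul, ipB_add_right])
        (fun c b x y => by rw [star_smul, E.smul_rsmul, ipB_smul_right])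
        (fun b b' y => by rw [star_mul, E.rsmul_mul])
        (fun b x y => E.ipB_compat x y (star b))
      exact hR a (ha R) x y
    refine eq_zero_of_span_eq_top hAnd E.fullA ?_
    rintro _ ⟨w, x, rfl⟩ _ ⟨y, z, rfl⟩
    rw [mul_assoc, ← rsmul_ipA, ← E.ipA_rsmul, E.ip_compat, hz, zero_lsmul, ipA_zero]
end
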